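/- Let K_sep denote the separable state space of a pair of qubits. For all rank-one orthogonal projections E, F on ℂ², the affine ratio satisfies r_{K_sep}(E ⊗ₖ E, F ⊗ₖ F) ≤ ((tr(E·F)).re)². -/

import Mathlib

open Kronecker

/-- The affine ratio (transition probability) of `x` and `y` relative to a convex
subset `K` of a real vector space. -/
noncomputable def affineRatio {V : Type*} [AddCommGroup V] [Module ℝ V]
    (K : Set V) (x y : V) : ℝ :=
  sInf {r : ℝ | ∃ f : V →ᵃ[ℝ] ℝ, (∀ z ∈ K, f z ∈ Set.Icc (0 : ℝ) 1) ∧ f x = 1 ∧ f y = r}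

/-- A rank-one orthogonal projection. -/
def IsRankOneProj {n : ℕ} (P : Matrix (Fin n) (Fin n) ℂ) : Prop :=
  P.IsHermitian ∧ P * P = P ∧ P.rank = 1

/-- The pure product states of a pair of qubits. -/
def pureProducts : Set (Matrix (Fin 2 × Fin 2) (Fin 2 × Fin 2) ℂ) :=
  {x | ∃ E F : Matrix (Fin 2) (Fin 2) ℂ, IsRankOneProj E ∧ IsRankOneProj F ∧ x = E ⊗ₖ F}

/-- The separable state space of a pair of qubits. -/
def Ksep : Set (Matrix (Fin 2 × Fin 2) (Fin 2 × Fin 2) ℂ) :=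
  convexHull ℝ pureProducts

open scoped ComplexOrder

/-- The trace of a rank-one orthogonal projection is one. -/
theorem IsRankOneProj.trace_eq_one {n : ℕ} {P : Matrix (Fin n) (Fin n) ℂ}
    (hP : IsRankOneProj P) : P.trace = 1 := by
  have hidem : IsIdempotentElem (Matrix.toLin' P) := by
    rw [IsIdempotentElem, Module.End.mul_eq_comp, ← Matrix.toLin'_mul, hP.2.1]
  rw [← Matrix.trace_toLin'_eq, (LinearMap.IsIdempotentElem.isProj_range _ hidem).trace,
    Matrix.toLin'_apply', ← Matrix.rank, hP.2.2, Nat.cast_one]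

/-- The trace of the product of two orthogonal projections is nonnegative. -/
theorem trace_mul_nonneg_of_projections {n : Type*} [Fintype n] {P Q : Matrix n n ℂ}
    (hP : P.IsHermitian) (hPP : P * P = P) (hQ : Q.IsHermitian) (hQQ : Q * Q = Q) :
    0 ≤ (P * Q).trace := by
  have h : (P * Q).trace = ((Q * P).conjTranspose * (Q * P)).trace := by
    rw [Matrix.conjTranspose_mul, hP.eq, hQ.eq, ← Matrix.mul_assoc, Matrix.mul_assoc P Q Q, hQQ,
      Matrix.trace_mul_comm (P * Q) P, ← Matrix.mul_assoc, hPP]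
  rw [h]
  exact (Matrix.posSemidef_conjTranspose_mul_self _).trace_nonneg

/-- The transition probability of two rank-one projections is a real number in `[0, 1]`. -/
theorem IsRankOneProj.trace_mul_mem_Icc {n : ℕ} {P Q : Matrix (Fin n) (Fin n) ℂ}
    (hP : IsRankOneProj P) (hQ : IsRankOneProj Q) :
    (P * Q).trace ∈ Set.Icc (0 : ℂ) 1 := by
  refine ⟨trace_mul_nonneg_of_projections hP.1 hP.2.1 hQ.1 hQ.2.1, ?_⟩
  have h := trace_mul_nonneg_of_projections hP.1 hP.2.1 (Matrix.isHermitian_one.sub hQ.1)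
    (IsIdempotentElem.one_sub hQ.2.1)
  rwa [mul_sub, mul_one, Matrix.trace_sub, hP.trace_eq_one, sub_nonneg] at h

/-- The real-linear functional `X ↦ Re tr (A X)`. -/
noncomputable def reTraceMul {n : Type*} [Fintype n] (A : Matrix n n ℂ) :
    Matrix n n ℂ →ₗ[ℝ] ℝ :=
  Complex.reLm ∘ₗ Matrix.traceLinearMap n ℝ ℂ ∘ₗ LinearMap.mulLeft ℝ A

theorem reTraceMul_kronecker {m n : Type*} [Fintype m] [Fintype n] (A C : Matrix m m ℂ)
    (B D : Matrix n n ℂ) :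
    reTraceMul (A ⊗ₖ B) (C ⊗ₖ D) = ((A * C).trace * (B * D).trace).re := by
  simp [reTraceMul, ← Matrix.mul_kronecker_mul, Matrix.trace_kronecker]

/-- The functional given by a product of rank-one projections is an effect on the
separable state space. -/
theorem reTraceMul_mem_Icc {E F : Matrix (Fin 2) (Fin 2) ℂ} (hE : IsRankOneProj E)
    (hF : IsRankOneProj F) {z : Matrix (Fin 2 × Fin 2) (Fin 2 × Fin 2) ℂ} (hz : z ∈ Ksep) :
    reTraceMul (E ⊗ₖ F) z ∈ Set.Icc (0 : ℝ) 1 := by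
  refine convexHull_min ?_ ((convex_Icc (0 : ℝ) 1).linear_preimage (reTraceMul (E ⊗ₖ F))) hz
  rintro _ ⟨G, H, hG, hH, rfl⟩
  obtain ⟨hG₀, hG₁⟩ := hE.trace_mul_mem_Icc hG
  obtain ⟨hH₀, hH₁⟩ := hF.trace_mul_mem_Icc hH
  rw [Set.mem_preimage, reTraceMul_kronecker]
  exact ⟨(Complex.le_def.1 (mul_nonneg hG₀ hH₀)).1,
    (Complex.le_def.1 (mul_le_one₀ hG₁ hH₀ hH₁)).1⟩

theorem stmt15 (E F : Matrix (Fin 2) (Fin 2) ℂ)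
    (hE : IsRankOneProj E) (hF : IsRankOneProj F) :
    affineRatio Ksep (E ⊗ₖ E) (F ⊗ₖ F) ≤ ((E * F).trace.re) ^ 2 := by
  have hmem : F ⊗ₖ F ∈ Ksep := subset_convexHull ℝ _ ⟨F, F, hF, hF, rfl⟩
  refine csInf_le ⟨0, ?_⟩ ⟨(reTraceMul (E ⊗ₖ E)).toAffineMap,
    fun z hz => reTraceMul_mem_Icc hE hE hz, ?_, ?_⟩
  · rintro _ ⟨f, hf, -, rfl⟩
    exact (hf _ hmem).1
  · simp [reTraceMul_kronecker, hE.2.1, hE.trace_eq_one]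
  · have him : (E * F).trace.im = 0 := (Complex.le_def.1 (hE.trace_mul_mem_Icc hF).1).2.symm
    simp [reTraceMul_kronecker, him, sq]
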